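/- arXiv:1302.0750 — 3 statements merged into one kernel-verified Lean document; each statement's English description precedes it below -/
import Mathlib

section
/- Let Σ be a finite alphabet and let L₁ and L₂ be finite languages over Σ accepted by partial DFAs with m states and n states respectively, where m, n ≥ 2. Then L₁ ∪ L₂ is accepted by a partial DFA with at most m·n − 2 states; in particular isc(L₁ ∪ L₂) ≤ m·n − 2. -/
open scoped Computability
open scoped Classical

/-- A partial DFA over alphabet `α` with state set `Fin n`. -/
structure PDFA (α : Type) (n : ℕ) where
  step : Fin n → α → Option (Fin n)
  start : Fin n
  accept : Finset (Fin n)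

namespace PDFA

variable {α : Type} {n : ℕ}

/-- Run the partial DFA from a state along a word; `none` if a transition is undefined. -/
def evalFrom (M : PDFA α n) : Fin n → List α → Option (Fin n)
  | q, [] => some q
  | q, a :: w => (M.step q a).bind fun q' => M.evalFrom q' w

/-- The language accepted by a partial DFA. -/
def lang (M : PDFA α n) : Language α :=
  {w | ∃ q ∈ M.accept, M.evalFrom M.start w = some q}

/-- The number of defined transitions. -/
noncomputable def transCount [Fintype α] (M : PDFA α n) : ℕ :=
  (Finset.univ.filter fun p : Fin n × α => (M.step p.1 p.2).isSome).card

/-- The number of defined `τ`-transitions. -/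
noncomputable def transCountOn (M : PDFA α n) (τ : α) : ℕ :=
  (Finset.univ.filter fun q : Fin n => (M.step q τ).isSome).card

/-- `s_τ`: 1 if a `τ`-transition is defined at the initial state, else 0. -/
def sOn (M : PDFA α n) (τ : α) : ℕ := if (M.step M.start τ).isSome then 1 else 0

/-- `s`: total over the alphabet of `s_τ`. -/
noncomputable def sTot [Fintype α] (M : PDFA α n) : ℕ := ∑ τ : α, M.sOn τ

/-- `s̄_τ = 1 - s_τ`. -/
def sbarOn (M : PDFA α n) (τ : α) : ℕ := 1 - M.sOn τ

/-- `a_τ`: the number of defined `τ`-transitions entering a final state. -/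
noncomputable def aOn (M : PDFA α n) (τ : α) : ℕ :=
  (Finset.univ.filter fun p : Fin n => ∃ q ∈ M.accept, M.step p τ = some q).card

/-- `e_τ`: the number of final states at which a `τ`-transition is defined. -/
noncomputable def eOn (M : PDFA α n) (τ : α) : ℕ :=
  (M.accept.filter fun q => (M.step q τ).isSome).card

/-- `ē_τ`: the number of final states at which no `τ`-transition is defined. -/
noncomputable def ebarOn (M : PDFA α n) (τ : α) : ℕ :=
  (M.accept.filter fun q => M.step q τ = none).card

/-- `t̄_τ`: the number of states at which no `τ`-transition is defined. -/
noncomputable def tbarOn (M : PDFA α n) (τ : α) : ℕ :=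
  (Finset.univ.filter fun q : Fin n => M.step q τ = none).card

/-- `f(A)`: the number of final states. -/
def fTot (M : PDFA α n) : ℕ := M.accept.card

/-- `f(A, i)`: the number of final states numbered strictly less than `i`. -/
noncomputable def fBelow (M : PDFA α n) (i : ℕ) : ℕ :=
  (M.accept.filter fun q => (q : ℕ) < i).card

/-- `t̄_τ(L, i)`: 1 if no `τ`-transition is defined at state `i`, else 0. -/
noncomputable def tbarAt (M : PDFA α n) (τ : α) (i : ℕ) : ℕ :=
  if h : i < n then (if M.step ⟨i, h⟩ τ = none then 1 else 0) else 0

/-- The states (numbered by `Fin n`) are topologically ordered: the initial state is `0`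
and every defined transition goes from a smaller-numbered to a larger-numbered state. -/
def Ordered (M : PDFA α n) : Prop :=
  (M.start : ℕ) = 0 ∧ ∀ q a q', M.step q a = some q' → q < q'

end PDFA

/-- The incomplete state complexity: the minimal number of states of a partial DFA
accepting `L`. -/
noncomputable def isc {α : Type} (L : Language α) : ℕ :=
  sInf {m | ∃ M : PDFA α m, M.lang = L}

/-- The incomplete transition complexity: the minimal number of defined transitions
over all partial DFAs accepting `L`. -/
noncomputable def itc {α : Type} [Fintype α] (L : Language α) : ℕ :=
  sInf {t | ∃ m, ∃ M : PDFA α m, M.lang = L ∧ M.transCount = t}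

/-- The minimal number of defined `τ`-transitions over all partial DFAs accepting `L`. -/
noncomputable def itcOn {α : Type} (L : Language α) (τ : α) : ℕ :=
  sInf {t | ∃ m, ∃ M : PDFA α m, M.lang = L ∧ M.transCountOn τ = t}


namespace PDFA

/-- The words leading from the state `q` to an accepting state. -/
def langFrom {α : Type} {n : ℕ} (M : PDFA α n) (q : Fin n) : Language α :=
  {w | ∃ p ∈ M.accept, M.evalFrom q w = some p}

lemma evalFrom_append {α : Type} {n : ℕ} (M : PDFA α n) (q : Fin n) (u v : List α) :
    M.evalFrom q (u ++ v) = (M.evalFrom q u).bind fun p => M.evalFrom p v := by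
  induction u generalizing q with
  | nil => rfl
  | cons a u ih => cases h : M.step q a <;> simp [evalFrom, h, ih]

lemma leftQuotient_lang {α : Type} {n : ℕ} (M : PDFA α n) (w : List α) :
    M.lang.leftQuotient w = (M.evalFrom M.start w).elim 0 M.langFrom := by
  ext v
  change (∃ p ∈ M.accept, M.evalFrom M.start (w ++ v) = some p) ↔ _
  rw [evalFrom_append]
  cases M.evalFrom M.start w with
  | none => simp [Language.notMem_zero]
  | some q => rfl

end PDFA

namespace Language

variable {α : Type} {L : Language α}

lemma exists_longest_mem (hf : Set.Finite {w : List α | w ∈ L}) {v : List α} (hv : v ∈ L) :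
    ∃ w ∈ L, ∀ u ∈ L, u.length ≤ w.length :=
  Set.exists_max_image _ List.length hf ⟨v, hv⟩

lemma eq_zero_of_leftQuotient_eq_self (hf : Set.Finite {w : List α | w ∈ L}) {w : List α}
    (hw : w ≠ []) (h : L.leftQuotient w = L) : L = 0 := by
  ext v
  refine iff_of_false (fun hv => ?_) (notMem_zero v)
  obtain ⟨x, hx, hmax⟩ := exists_longest_mem hf hv
  have hwx : w ++ x ∈ L := by rw [← h] at hx; exact hx
  have := hmax _ hwx
  have := List.length_pos_iff.mpr hw
  simp only [List.length_append] at *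
  omega

lemma exists_leftQuotient_eq_one (hf : Set.Finite {w : List α | w ∈ L}) {v : List α}
    (hv : v ∈ L) (hne : v ≠ []) : ∃ w ≠ [], L.leftQuotient w = 1 := by
  obtain ⟨w, hw, hmax⟩ := exists_longest_mem hf hv
  refine ⟨w, ?_, ?_⟩
  · rintro rfl
    exact hne (List.length_eq_zero_iff.mp (Nat.le_zero.mp (hmax v hv)))
  · ext y
    rw [mem_one]
    constructor
    · intro hy
      have := hmax (w ++ y) hy
      rw [List.length_append] at this
      exact List.length_eq_zero_iff.mp (by omega)
    · rintro rfl
      change w ++ [] ∈ L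
      rwa [List.append_nil]

/-- A finite set of languages that contains `L` and all its nonempty left quotients
yields a partial DFA for `L`. -/
lemma exists_PDFA_of_leftQuotient_mem (S : Finset (Language α)) (hL : L ∈ S)
    (hS : ∀ w, L.leftQuotient w = 0 ∨ L.leftQuotient w ∈ S) :
    ∃ C : PDFA α S.card, C.lang = L := by
  let e : S ≃ Fin S.card := S.equivFin
  let C : PDFA α S.card :=
    { step := fun q a =>
        if h : (e.symm q).1.leftQuotient [a] ∈ S then some (e ⟨_, h⟩) else none
      start := e ⟨L, hL⟩
      accept := Finset.univ.filter fun q => [] ∈ (e.symm q).1 }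
  have key : ∀ w u (h : L.leftQuotient u ∈ S),
      w ∈ C.langFrom (e ⟨_, h⟩) ↔ u ++ w ∈ L := by
    intro w
    induction w with
    | nil =>
      intro u h
      change (∃ p ∈ C.accept, some (e ⟨_, h⟩) = some p) ↔ _
      simp [C]
    | cons a w ih =>
      intro u h
      have hstep : C.step (e ⟨_, h⟩) a =
          if h' : L.leftQuotient (u ++ [a]) ∈ S then some (e ⟨_, h'⟩) else none := by
        simp only [C, Equiv.symm_apply_apply, leftQuotient_append]
      change (∃ p ∈ C.accept, (C.step _ a).bind (fun q => C.evalFrom q w) = some p) ↔ _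
      rw [hstep, List.append_cons u a w]
      split_ifs with h'
      · exact ih _ h'
      · have h0 := (hS (u ++ [a])).resolve_right h'
        refine iff_of_false (by simp) fun hw => notMem_zero w ?_
        rw [← h0]
        exact hw
  exact ⟨C, Set.ext fun w => key w [] hL⟩

/-- A finite language recognised by `m` states has, counting the empty language, at most `m`
left quotients by nonempty words. Unless there is no other one, `{ε}` is among them. -/
lemma exists_finset_leftQuotient {m : ℕ} (M : PDFA α m)
    (hf : Set.Finite {w : List α | w ∈ M.lang}) :
    ∃ A : Finset (Language α), A.card ≤ m ∧ 0 ∈ A ∧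
      (∀ w ≠ [], M.lang.leftQuotient w ∈ A) ∧ (1 ∈ A ∨ A = {0}) := by
  by_cases h : ∃ v ∈ M.lang, v ≠ []
  · obtain ⟨v, hv, hne⟩ := h
    let g : Fin m → Language α := fun q => if q = M.start then 0 else M.langFrom q
    have h0 : 0 ∈ Finset.univ.image g :=
      Finset.mem_image.mpr ⟨M.start, Finset.mem_univ _, if_pos rfl⟩
    have hA : ∀ w ≠ [], M.lang.leftQuotient w ∈ Finset.univ.image g := by
      intro w hw
      have hq := M.leftQuotient_lang w
      cases he : M.evalFrom M.start w with
      | none => rw [hq, he]; exact h0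
      | some q =>
        rw [he] at hq
        by_cases hs : q = M.start
        · subst hs
          have hz := eq_zero_of_leftQuotient_eq_self hf hw hq
          rw [hq]
          change M.lang ∈ _
          rwa [hz]
        · rw [hq]
          exact Finset.mem_image.mpr ⟨q, Finset.mem_univ _, if_neg hs⟩
    obtain ⟨w, hw, hw1⟩ := exists_leftQuotient_eq_one hf hv hne
    exact ⟨_, Finset.card_image_le.trans (by simp), h0, hA, .inl (hw1 ▸ hA w hw)⟩
  · push Not at h
    refine ⟨{0}, ?_, by simp, fun w hw => ?_, .inr rfl⟩
    · have := M.start.pos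
      simpa
    · rw [Finset.mem_singleton]
      ext v
      refine iff_of_false (fun hv => hw ?_) (notMem_zero v)
      exact (List.append_eq_nil_iff.mp (h (w ++ v) hv)).1

end Language

lemma Finset.card_image₂_sup_erase_bot_le {β : Type*} [SemilatticeSup β] [OrderBot β]
    {A B : Finset β} {x : β} (hx : x ≠ ⊥) (hA : ⊥ ∈ A) (hB : ⊥ ∈ B) (hxA : x ∈ A)
    (hxB : x ∈ B) :
    ((Finset.image₂ (· ⊔ ·) A B).erase ⊥).card + 3 ≤ A.card * B.card := by
  let D : Finset (β × β) := {(⊥, ⊥), (x, ⊥), (⊥, x)}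
  have hD : D.card = 3 := by simp [D, hx, hx.symm]
  have hDAB : D ⊆ A ×ˢ B := by
    simp [D, Finset.insert_subset_iff, hA, hB, hxA, hxB]
  have hsub : (Finset.image₂ (· ⊔ ·) A B).erase ⊥ ⊆
      ((A ×ˢ B) \ D).image fun p => p.1 ⊔ p.2 := by
    intro y hy
    obtain ⟨hy0, hy⟩ := Finset.mem_erase.mp hy
    obtain ⟨a, ha, b, hb, rfl⟩ := Finset.mem_image₂.mp hy
    rw [Finset.mem_image]
    by_cases h : (a, b) ∈ D
    · refine ⟨(x, x), ?_, ?_⟩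
      · simp [D, hxA, hxB, hx]
      · simp only [D, Finset.mem_insert, Finset.mem_singleton, Prod.mk.injEq] at h
        rcases h with ⟨rfl, rfl⟩ | ⟨rfl, rfl⟩ | ⟨rfl, rfl⟩ <;> simp_all
    · exact ⟨(a, b), by simp [ha, hb, h], rfl⟩
  have h1 := (Finset.card_le_card hsub).trans Finset.card_image_le
  have h2 := Finset.card_le_card hDAB
  rw [Finset.card_sdiff_of_subset hDAB] at h1
  rw [Finset.card_product] at h1 h2
  omega

/-- If finite languages `L₁`, `L₂` over a finite alphabet are accepted by
partial DFAs with `m` and `n` states respectively (`m, n ≥ 2`), then `L₁ ∪ L₂` is accepted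
by a partial DFA with at most `m·n − 2` states; in particular `isc (L₁ ∪ L₂) ≤ m·n − 2`. -/
theorem union_isc_upper {α : Type} [Fintype α] {m n : ℕ} (hm : 2 ≤ m) (hn : 2 ≤ n)
    (L₁ L₂ : Language α)
    (hf₁ : Set.Finite {w : List α | w ∈ L₁}) (hf₂ : Set.Finite {w : List α | w ∈ L₂})
    (M₁ : PDFA α m) (hM₁ : M₁.lang = L₁) (M₂ : PDFA α n) (hM₂ : M₂.lang = L₂) :
    (∃ k, k ≤ m * n - 2 ∧ ∃ C : PDFA α k, C.lang = L₁ ⊔ L₂) ∧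
      isc (L₁ ⊔ L₂) ≤ m * n - 2 := by
  subst hM₁ hM₂
  suffices h : ∃ k, k ≤ m * n - 2 ∧ ∃ C : PDFA α k, C.lang = M₁.lang ⊔ M₂.lang by
    obtain ⟨k, hk, C, hC⟩ := h
    exact ⟨⟨k, hk, C, hC⟩, (Nat.sInf_le (Exists.intro C hC)).trans hk⟩
  obtain ⟨A, hAm, hA0, hA, hA1⟩ := Language.exists_finset_leftQuotient M₁ hf₁
  obtain ⟨B, hBn, hB0, hB, hB1⟩ := Language.exists_finset_leftQuotient M₂ hf₂
  let T : Finset (Language α) := (Finset.image₂ (· ⊔ ·) A B).erase ⊥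
  have hT : T.card + 1 ≤ m * n - 2 := by
    have h_card_erase {X : Finset (Language α)} (h : 0 ∈ X) : (X.erase ⊥).card + 1 = X.card :=
      Finset.card_erase_add_one h
    have hmn : n ≤ m * n - 2 := by
      have := Nat.mul_le_mul_right n hm
      omega
    have hnm : m ≤ m * n - 2 := by
      have := Nat.mul_le_mul_left m hn
      omega
    rcases hA1 with hA1 | rfl
    · rcases hB1 with hB1 | rfl
      · have h10 : (1 : Language α) ≠ ⊥ := fun h => by
          have h1 : [] ∈ (1 : Language α) := Language.nil_mem_one
          rw [h] at h1
          exact Language.notMem_zero _ h1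
        have : T.card + 3 ≤ A.card * B.card :=
          Finset.card_image₂_sup_erase_bot_le h10 hA0 hB0 hA1 hB1
        have := Nat.mul_le_mul hAm hBn
        omega
      · have hTA : T = A.erase ⊥ := by
          simp only [T, Finset.image₂_singleton_right]
          exact congrArg (Finset.erase · ⊥)
            ((Finset.image_congr fun X _ => sup_bot_eq X).trans Finset.image_id)
        rw [hTA, h_card_erase hA0]
        exact hAm.trans hnm
    · have hTB : T = B.erase ⊥ := by
        simp only [T, Finset.image₂_singleton_left]
        exact congrArg (Finset.erase · ⊥)
          ((Finset.image_congr fun X _ => bot_sup_eq X).trans Finset.image_id)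
      rw [hTB, h_card_erase hB0]
      exact hBn.trans hmn
  refine ⟨_, (Finset.card_insert_le (M₁.lang ⊔ M₂.lang) T).trans hT,
    Language.exists_PDFA_of_leftQuotient_mem _ (Finset.mem_insert_self _ _) fun w => ?_⟩
  rcases eq_or_ne w [] with rfl | hw
  · exact .inr (Finset.mem_insert_self _ _)
  · rw [or_iff_not_imp_left]
    exact fun h0 => Finset.mem_insert_of_mem
      (Finset.mem_erase.mpr ⟨h0, Finset.mem_image₂_of_mem (hA w hw) (hB w hw)⟩)
end

section
/- Let Σ be a finite alphabet of size |Σ| and let L be a finite language over Σ with isc(L) = m. Then itc(Σ* \ L) ≤ |Σ|·(m + 1). -/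
open scoped Computability
open scoped Classical

namespace PDFA

variable {α : Type} {n : ℕ}

/-- The partial DFA for the complement: make `M` total by adding a sink state, which `finSuccEquivLast`
identifies with `none`, then exchange final and non-final states. -/
noncomputable def compl (M : PDFA α n) : PDFA α (n + 1) where
  step q a := some (finSuccEquivLast.symm ((finSuccEquivLast q).bind fun p => M.step p a))
  start := finSuccEquivLast.symm (some M.start)
  accept := Finset.univ.filter fun q => ¬ ∃ p ∈ M.accept, finSuccEquivLast q = some p

theorem evalFrom_compl (M : PDFA α n) (o : Option (Fin n)) (w : List α) :
    M.compl.evalFrom (finSuccEquivLast.symm o) w =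
      some (finSuccEquivLast.symm (o.bind fun p => M.evalFrom p w)) := by
  induction w generalizing o with
  | nil => simp [evalFrom]
  | cons a w ih =>
    have hstep : M.compl.step (finSuccEquivLast.symm o) a =
        some (finSuccEquivLast.symm (o.bind fun p => M.step p a)) := by
      simp [compl]
    simp only [evalFrom, hstep, Option.bind_some, ih, Option.bind_assoc]

theorem lang_compl (M : PDFA α n) : M.compl.lang = M.langᶜ := by
  ext w
  change (∃ q ∈ M.compl.accept, M.compl.evalFrom (finSuccEquivLast.symm (some M.start)) w = some q) ↔
    ¬ ∃ q ∈ M.accept, M.evalFrom M.start w = some q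
  rw [evalFrom_compl]
  simp [compl]

theorem transCount_le [Fintype α] (M : PDFA α n) : M.transCount ≤ Fintype.card α * n := by
  refine (Finset.card_le_univ _).trans_eq ?_
  rw [Fintype.card_prod, Fintype.card_fin, mul_comm]

end PDFA

theorem itc_le_transCount {α : Type} [Fintype α] {n : ℕ} (M : PDFA α n) :
    itc M.lang ≤ M.transCount :=
  Nat.sInf_le ⟨n, M, rfl, rfl⟩

/-- For a finite language `L` over a finite alphabet `Σ` with
`isc L = m`, one has `itc (Lᶜ) ≤ |Σ|·(m + 1)`. -/
theorem compl_itc_upper {α : Type} [Fintype α] {m : ℕ} (L : Language α)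
    (hf : Set.Finite {w : List α | w ∈ L}) (h : isc L = m) :
    itc Lᶜ ≤ Fintype.card α * (m + 1) := by
  -- Finiteness is not needed: if no partial DFA accepts `L`, none accepts `Lᶜ`, and `itc Lᶜ = 0`.
  by_cases hL : {k | ∃ M : PDFA α k, M.lang = L}.Nonempty
  · obtain ⟨M, rfl⟩ : ∃ M : PDFA α m, M.lang = L := h ▸ Nat.sInf_mem hL
    rw [← M.lang_compl]
    exact (itc_le_transCount _).trans M.compl.transCount_le
  · have hempty : {t | ∃ k, ∃ M : PDFA α k, M.lang = Lᶜ ∧ M.transCount = t} = ∅ := by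
      refine Set.eq_empty_of_forall_notMem ?_
      rintro t ⟨k, M, hM, -⟩
      exact hL ⟨k + 1, M.compl, by rw [M.lang_compl, hM, compl_compl]⟩
    simp [itc, hempty]
end

section
/- Let Σ be an alphabet of size k and let A and B be complete DFAs over Σ with m states and n states respectively (m, n ≥ 2), both accepting finite languages. Then the concatenation L(A)·L(B) is accepted by a complete DFA with at most Σ_{i=0}^{m−2} min{ k^i, Σ_{j=0}^{f(A,i)} C(n−2, j) } + Σ_{j=0}^{f(A)} C(n−2, j) states, where C(·,·) denotes the binomial coefficient. -/
open scoped Computability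
open scoped Classical

/-- A complete DFA over alphabet `α` with state set `Fin n`. -/
structure CDFA (α : Type) (n : ℕ) where
  step : Fin n → α → Fin n
  start : Fin n
  accept : Finset (Fin n)

namespace CDFA

variable {α : Type} {n : ℕ}

/-- Run the complete DFA from a state along a word. -/
def evalFrom (M : CDFA α n) : Fin n → List α → Fin n
  | q, [] => q
  | q, a :: w => M.evalFrom (M.step q a) w

/-- The language accepted by a complete DFA. -/
def lang (M : CDFA α n) : Language α :=
  {w | M.evalFrom M.start w ∈ M.accept}

/-- `f(A, i)`: the number of final states numbered strictly less than `i`. -/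
noncomputable def fBelow (M : CDFA α n) (i : ℕ) : ℕ :=
  (M.accept.filter fun q => (q : ℕ) < i).card

end CDFA

namespace CDFA

variable {α : Type} {m n : ℕ}

theorem evalFrom_append (M : CDFA α n) (q : Fin n) (u v : List α) :
    M.evalFrom q (u ++ v) = M.evalFrom (M.evalFrom q u) v := by
  induction u generalizing q with
  | nil => rfl
  | cons a u ih => exact ih (M.step q a)

theorem mem_lang (M : CDFA α n) (w : List α) :
    w ∈ M.lang ↔ M.evalFrom M.start w ∈ M.accept := Iff.rfl

theorem fBelow_eq_card_filter (M : CDFA α n) (i : ℕ) :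
    M.fBelow i = (M.accept.filter fun q : Fin n => q.val < i).card := by
  rw [fBelow, ← Finset.card_image_of_injective (M.accept.filter fun q : Fin n => q.val < i)
    Fin.val_injective]
  congr 1
  ext k
  simp only [Finset.mem_filter, Finset.mem_image, Finset.bind_def, Finset.pure_def,
    Finset.mem_sup, Finset.mem_singleton]
  constructor
  · rintro ⟨⟨q, hq, rfl⟩, hk⟩
    exact ⟨q, ⟨hq, hk⟩, rfl⟩
  · rintro ⟨q, ⟨hq, hk⟩, rfl⟩
    exact ⟨⟨q, hq, rfl⟩, hk⟩

/-- A language with at most `N` left quotients is accepted by a complete DFA with at most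
`N` states. -/
theorem exists_lang_eq_of_encard_leftQuotient_le {L : Language α} {N : ℕ}
    (h : (Set.range L.leftQuotient).encard ≤ N) :
    ∃ N' ≤ N, ∃ C : CDFA α N', C.lang = L := by
  have hfin : (Set.range L.leftQuotient).Finite := Set.finite_of_encard_le_coe h
  have : Finite (Set.range L.leftQuotient) := hfin
  let e := Finite.equivFin (Set.range L.leftQuotient)
  let C : CDFA α (Nat.card (Set.range L.leftQuotient)) :=
    { step := fun i a => e (L.toDFA.step (e.symm i) a)
      start := e L.toDFA.start
      accept := Finset.univ.filter fun i => e.symm i ∈ L.toDFA.accept }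
  have heval : ∀ (w : List α) s, C.evalFrom (e s) w = e (L.toDFA.evalFrom s w) := by
    intro w
    induction w with
    | nil => intro s; rfl
    | cons a w ih =>
      intro s
      have : C.step (e s) a = e (L.toDFA.step s a) :=
        congrArg (fun t => e (L.toDFA.step t a)) (e.symm_apply_apply s)
      rw [evalFrom, this, ih]
      rfl
  refine ⟨_, ?_, C, ?_⟩
  · rw [Nat.card_coe_set_eq]
    exact_mod_cast hfin.cast_ncard_eq.trans_le h
  · conv_rhs => rw [← L.accepts_toDFA]
    ext w
    rw [mem_lang, show C.start = e L.toDFA.start from rfl, heval, DFA.mem_accepts]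
    simp only [C, Finset.mem_filter, Finset.mem_univ, true_and, Equiv.symm_apply_apply]
    rfl

/-- If a word avoids the absorbing state `d`, it advances the state by at least its length. -/
theorem add_length_le_evalFrom {A : CDFA α m} {d : Fin m} (hd : ∀ a, A.step d a = d)
    (hord : ∀ q a, q ≠ d → A.step q a ≠ d → q < A.step q a) (q : Fin m) (w : List α)
    (hw : A.evalFrom q w ≠ d) : (q : ℕ) + w.length ≤ A.evalFrom q w := by
  have habs : ∀ w, A.evalFrom d w = d := fun w => by
    induction w with
    | nil => rfl
    | cons a w ih => rw [evalFrom, hd, ih]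
  induction w generalizing q with
  | nil => simp [evalFrom]
  | cons a w ih =>
    rw [evalFrom] at hw ⊢
    have h1 := ih _ hw
    have h2 : A.step q a ≠ d := fun h => hw (by rw [h, habs])
    have h3 : q ≠ d := fun h => h2 (by rw [h, hd])
    have h4 : (q : ℕ) < A.step q a := hord q a h3 h2
    rw [List.length_cons]
    omega

/-- At most `k ^ i` words lead from a state `q` to a state `i` other than the absorbing one. -/
theorem encard_evalFrom_eq_le [Fintype α] {A : CDFA α m} {d : Fin m}
    (hd : ∀ a, A.step d a = d)
    (hord : ∀ q a, q ≠ d → A.step q a ≠ d → q < A.step q a) [Nonempty α] (q i : Fin m)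
    (hi : i ≠ d) : {w | A.evalFrom q w = i}.encard ≤ (Fintype.card α ^ (i : ℕ) : ℕ) := by
  have hlen : ∀ w, A.evalFrom q w = i → w.length ≤ i := fun w hw => by
    have := add_length_le_evalFrom hd hord q w (hw ▸ hi)
    rw [hw] at this
    omega
  let pad : List α → Fin i → α := fun w j => w.getD j (Classical.arbitrary α)
  have key : ∀ w w', A.evalFrom q w = i → A.evalFrom q w' = i → w.length ≤ w'.length →
      pad w = pad w' → w = w' := by
    intro w w' hw hw' hle hp
    have hpre : w' = w ++ w'.drop w.length := by
      conv_lhs => rw [← List.take_append_drop w.length w']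
      congr 1
      refine List.ext_getElem (by simpa using hle) fun j h1 h2 => ?_
      have := congrFun hp ⟨j, h2.trans_le (hlen w hw)⟩
      simp only [pad, List.getD_eq_getElem _ _ h2,
        List.getD_eq_getElem _ _ (h2.trans_le hle)] at this
      rw [this, List.getElem_take]
    have h := hw'
    rw [hpre, evalFrom_append, hw] at h
    have := add_length_le_evalFrom hd hord i _ (h ▸ hi)
    rw [h] at this
    have hz : w'.drop w.length = [] := List.length_eq_zero_iff.mp (by omega)
    rw [hpre, hz, List.append_nil]
  have hinj : Set.InjOn pad {w | A.evalFrom q w = i} := fun w hw w' hw' hp =>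
    (le_total w.length w'.length).elim (fun h => key w w' hw hw' h hp)
      fun h => (key w' w hw' hw h hp.symm).symm
  calc {w | A.evalFrom q w = i}.encard = (pad '' {w | A.evalFrom q w = i}).encard :=
        hinj.encard_image.symm
    _ ≤ (Set.univ : Set (Fin i → α)).encard := Set.encard_le_encard (Set.subset_univ _)
    _ = _ := by rw [Set.encard_univ, ENat.card_eq_coe_fintype_card]; simp

/-- The states from which `B` can accept and which `B` may occupy after reading a nonempty
suffix of `w` left over from a prefix accepted by `A`. -/
noncomputable def pending (A : CDFA α m) (B : CDFA α n) (w : List α) : Finset (Fin n) :=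
  Finset.univ.filter fun q => (∃ v, B.evalFrom q v ∈ B.accept) ∧
    ∃ x u, x ++ u = w ∧ u ≠ [] ∧ x ∈ A.lang ∧ B.evalFrom B.start u = q

theorem mem_leftQuotient_mul (A : CDFA α m) (B : CDFA α n) (w v : List α) :
    v ∈ (A.lang * B.lang).leftQuotient w ↔
      (∃ x y, A.evalFrom (A.evalFrom A.start w) x ∈ A.accept ∧ y ∈ B.lang ∧ x ++ y = v) ∨
        ∃ q ∈ pending A B w, B.evalFrom q v ∈ B.accept := by
  rw [Language.mem_leftQuotient, Language.mem_mul]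
  constructor
  · rintro ⟨x, hx, y, hy, h⟩
    by_cases hle : w.length ≤ x.length
    · obtain ⟨z, rfl⟩ : w <+: x :=
        List.prefix_of_prefix_length_le ⟨v, rfl⟩ ⟨y, h⟩ hle
      rw [List.append_assoc, List.append_cancel_left_eq] at h
      rw [mem_lang, evalFrom_append] at hx
      exact Or.inl ⟨z, y, hx, hy, h⟩
    · obtain ⟨u, rfl⟩ : x <+: w :=
        List.prefix_of_prefix_length_le ⟨y, h⟩ ⟨v, rfl⟩ (by omega)
      rw [List.append_assoc, List.append_cancel_left_eq] at h
      subst h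
      rw [mem_lang, evalFrom_append] at hy
      refine Or.inr ⟨B.evalFrom B.start u, ?_, hy⟩
      simp only [pending, Finset.mem_filter, Finset.mem_univ, true_and]
      exact ⟨⟨v, hy⟩, x, u, rfl, by rintro rfl; simp at hle, hx, rfl⟩
  · rintro (⟨x, y, hx, hy, rfl⟩ | ⟨q, hq, hv⟩)
    · exact ⟨w ++ x, by rwa [mem_lang, evalFrom_append], y, hy, by simp⟩
    · simp only [pending, Finset.mem_filter, Finset.mem_univ, true_and] at hq
      obtain ⟨-, x, u, rfl, -, hx, rfl⟩ := hq
      exact ⟨x, hx, u ++ v, by rwa [mem_lang, evalFrom_append], by simp⟩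

/-- The number of pending states is at most the number of final states of `A` that are visited
along `w` before its end. -/
theorem card_pending_le {A : CDFA α m} (B : CDFA α n) {d : Fin m} (hd : ∀ a, A.step d a = d)
    (hdacc : d ∉ A.accept) (hord : ∀ q a, q ≠ d → A.step q a ≠ d → q < A.step q a)
    (w : List α) {F : Finset (Fin m)}
    (hF : ∀ x u, x ++ u = w → u ≠ [] → x ∈ A.lang → A.evalFrom A.start x ∈ F) :
    (pending A B w).card ≤ F.card := by
  have hp : ∀ s : Fin n, s ∈ pending A B w →
      ∃ x u, x ++ u = w ∧ u ≠ [] ∧ x ∈ A.lang ∧ B.evalFrom B.start u = s := fun s hs => by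
    simp only [pending, Finset.mem_filter, Finset.mem_univ, true_and] at hs
    exact hs.2
  choose! x u hxu hu hx hs using hp
  have key : ∀ s ∈ pending A B w, ∀ t ∈ pending A B w,
      A.evalFrom A.start (x s) = A.evalFrom A.start (x t) →
      (x s).length ≤ (x t).length → s = t := by
    intro s hs' t ht' he hle
    obtain ⟨z, hz⟩ : x s <+: x t :=
      List.prefix_of_prefix_length_le ⟨_, hxu s hs'⟩ ⟨_, hxu t ht'⟩ hle
    have hnd : A.evalFrom A.start (x t) ≠ d := fun h => hdacc (h ▸ hx t ht')
    have h1 := add_length_le_evalFrom hd hord (A.evalFrom A.start (x s)) z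
      (by rwa [← evalFrom_append, hz])
    rw [← evalFrom_append, hz, he] at h1
    have hz0 : z = [] := List.length_eq_zero_iff.mp (by omega)
    rw [hz0, List.append_nil] at hz
    have h2 := (hxu s hs').trans (hxu t ht').symm
    rw [hz, List.append_cancel_left_eq] at h2
    rw [← hs s hs', ← hs t ht', h2]
  refine Finset.card_le_card_of_injOn (fun s => A.evalFrom A.start (x s))
    (fun s hs' => hF _ _ (hxu s hs') (hu s hs') (hx s hs')) fun s hs' t ht' he => ?_
  exact (le_total _ _).elim (key s hs' t ht' he) fun h => (key t ht' s hs' he.symm h).symm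

/-- The useful states of `B` that can be reached by a nonempty word. -/
noncomputable def usefulNoninitial (B : CDFA α n) : Finset (Fin n) :=
  Finset.univ.filter fun q => (∃ v, B.evalFrom q v ∈ B.accept) ∧
    ∃ u, u ≠ [] ∧ B.evalFrom B.start u = q

theorem pending_subset_usefulNoninitial (A : CDFA α m) (B : CDFA α n) (w : List α) :
    pending A B w ⊆ usefulNoninitial B := by
  intro q hq
  simp only [pending, usefulNoninitial, Finset.mem_filter, Finset.mem_univ, true_and] at hq ⊢
  obtain ⟨h, x, u, -, hu, -, hq⟩ := hq
  exact ⟨h, u, hu, hq⟩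

/-- A complete DFA for a nonempty finite language has a useless state besides the initial one,
and the initial state is never entered again on an accepting run. -/
theorem card_usefulNoninitial_le [Nonempty α] {B : CDFA α n}
    (hfin : {w : List α | w ∈ B.lang}.Finite) (hne : ∃ w, w ∈ B.lang) :
    (usefulNoninitial B).card ≤ n - 2 := by
  obtain ⟨l, hl⟩ : ∃ l, ∀ w ∈ B.lang, w.length ≤ l := by
    obtain ⟨l, hl⟩ := (hfin.image List.length).bddAbove
    exact ⟨l, fun w hw => hl ⟨w, hw, rfl⟩⟩
  let a : α := Classical.arbitrary α
  let d := B.evalFrom B.start (List.replicate (l + 1) a)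
  have hduse : ¬ ∃ v, B.evalFrom d v ∈ B.accept := by
    rintro ⟨v, hv⟩
    rw [← evalFrom_append] at hv
    have := hl _ hv
    rw [List.length_append, List.length_replicate] at this
    omega
  have hstart : B.start ∉ usefulNoninitial B := by
    simp only [usefulNoninitial, Finset.mem_filter, Finset.mem_univ, true_and]
    rintro ⟨⟨v, hv⟩, u, hu, hloop⟩
    have hiter : ∀ j : ℕ, ∃ w, j ≤ w.length ∧ w ∈ B.lang := by
      intro j
      induction j with
      | zero => exact ⟨v, Nat.zero_le _, hv⟩
      | succ j ih =>
        obtain ⟨w, hw, hacc⟩ := ih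
        refine ⟨u ++ w, ?_, by rwa [mem_lang, evalFrom_append, hloop]⟩
        have := List.length_pos_iff.mpr hu
        rw [List.length_append]
        omega
    obtain ⟨w, hw, hacc⟩ := hiter (l + 1)
    have := hl w hacc
    omega
  have hdne : B.start ≠ d := fun h => hduse (h ▸ hne)
  have hsub : usefulNoninitial B ⊆ (Finset.univ.erase B.start).erase d := by
    intro q hq
    refine Finset.mem_erase.mpr ⟨?_, Finset.mem_erase.mpr ⟨?_, Finset.mem_univ q⟩⟩
    · rintro rfl
      exact hduse (Finset.mem_filter.mp hq).2.1
    · rintro rfl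
      exact hstart hq
  refine (Finset.card_le_card hsub).trans (le_of_eq ?_)
  rw [Finset.card_erase_of_mem (by simp [hdne.symm]), Finset.card_erase_of_mem (by simp),
    Finset.card_univ, Fintype.card_fin]
  omega

/-- If the words of `W` all lead `A` to the same state and have at most `f` pending states, then
they yield at most `∑ j ≤ f, C(c, j)` left quotients of the concatenation. -/
theorem encard_image_leftQuotient_mul_le (A : CDFA α m) (B : CDFA α n) {c f : ℕ}
    (hc : (usefulNoninitial B).card ≤ c) {W : Set (List α)} {p : Fin m}
    (hp : ∀ w ∈ W, A.evalFrom A.start w = p) (hf : ∀ w ∈ W, (pending A B w).card ≤ f) :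
    ((A.lang * B.lang).leftQuotient '' W).encard ≤
      (∑ j ∈ Finset.range (f + 1), c.choose j : ℕ) := by
  let T := (Finset.range (f + 1)).biUnion fun j => (usefulNoninitial B).powersetCard j
  let g : Finset (Fin n) → Language α := fun S =>
    {v | (∃ x y, A.evalFrom p x ∈ A.accept ∧ y ∈ B.lang ∧ x ++ y = v) ∨
      ∃ q ∈ S, B.evalFrom q v ∈ B.accept}
  have hsub : (A.lang * B.lang).leftQuotient '' W ⊆ g '' T := by
    rintro _ ⟨w, hw, rfl⟩
    refine ⟨pending A B w, ?_, ?_⟩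
    · simp only [T, Finset.coe_biUnion, Set.mem_iUnion, Finset.mem_coe, Finset.mem_range,
        Finset.mem_powersetCard]
      exact ⟨_, Nat.lt_succ_of_le (hf w hw), pending_subset_usefulNoninitial A B w, rfl⟩
    · ext v
      rw [mem_leftQuotient_mul, hp w hw]
      rfl
  have hT : T.card ≤ ∑ j ∈ Finset.range (f + 1), c.choose j :=
    Finset.card_biUnion_le.trans <| Finset.sum_le_sum fun j _ => by
      rw [Finset.card_powersetCard]
      exact Nat.choose_le_choose j hc
  calc _ ≤ (g '' T).encard := Set.encard_le_encard hsub
    _ ≤ (T : Set (Finset (Fin n))).encard := Set.encard_image_le _ _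
    _ = T.card := Set.encard_coe_eq_coe_finsetCard T
    _ ≤ _ := by exact_mod_cast hT

/-- The state bound for concatenation when the last state of `A` is absorbing. -/
theorem encard_range_leftQuotient_mul_le [Fintype α] [Nonempty α] {A : CDFA α (m + 1)}
    {B : CDFA α n} (hd : ∀ a, A.step (Fin.last m) a = Fin.last m)
    (hdacc : Fin.last m ∉ A.accept)
    (hord : ∀ q a, q ≠ Fin.last m → A.step q a ≠ Fin.last m → q < A.step q a) {c : ℕ}
    (hc : (usefulNoninitial B).card ≤ c) :
    (Set.range (A.lang * B.lang).leftQuotient).encard ≤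
      (((∑ i ∈ Finset.range m, min (Fintype.card α ^ i)
        (∑ j ∈ Finset.range (A.fBelow i + 1), c.choose j)) +
          ∑ j ∈ Finset.range (A.accept.card + 1), c.choose j : ℕ) : ℕ∞) := by
  let W : Fin (m + 1) → Set (List α) := fun i => {w | A.evalFrom A.start w = i}
  let b : Fin (m + 1) → ℕ := Fin.snoc (α := fun _ => ℕ)
    (fun i : Fin m => min (Fintype.card α ^ (i : ℕ))
      (∑ j ∈ Finset.range (A.fBelow i + 1), c.choose j))
    (∑ j ∈ Finset.range (A.accept.card + 1), c.choose j)
  have hb : ∀ i, ((A.lang * B.lang).leftQuotient '' W i).encard ≤ b i := by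
    intro i
    refine Fin.lastCases ?_ (fun i => ?_) i
    · simp only [b, Fin.snoc_last]
      exact encard_image_leftQuotient_mul_le A B hc (fun _ hw => hw) fun w _ =>
        card_pending_le B hd hdacc hord w fun _ _ _ _ hx => hx
    · simp only [b, Fin.snoc_castSucc]
      rw [Nat.mono_cast.map_min]
      refine le_min ((Set.encard_image_le _ _).trans ?_) ?_
      · exact encard_evalFrom_eq_le hd hord A.start i.castSucc (Fin.castSucc_ne_last i)
      · refine encard_image_leftQuotient_mul_le A B hc (fun _ hw => hw) fun w hw => ?_
        rw [fBelow_eq_card_filter]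
        refine card_pending_le B hd hdacc hord w fun x u hxu hu hx => ?_
        refine Finset.mem_filter.mpr ⟨hx, ?_⟩
        have hw' : A.evalFrom A.start w = i.castSucc := hw
        rw [← hxu, evalFrom_append] at hw'
        have h1 := add_length_le_evalFrom hd hord (A.evalFrom A.start x) u
          (hw' ▸ Fin.castSucc_ne_last i)
        rw [hw', Fin.val_castSucc] at h1
        have := List.length_pos_iff.mpr hu
        omega
  have hrange : Set.range (A.lang * B.lang).leftQuotient =
      ⋃ i, (A.lang * B.lang).leftQuotient '' W i := by
    ext K
    simp [W]
  have hsum : ∑ i, b i = (∑ i ∈ Finset.range m, min (Fintype.card α ^ i)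
      (∑ j ∈ Finset.range (A.fBelow i + 1), c.choose j)) +
        ∑ j ∈ Finset.range (A.accept.card + 1), c.choose j := by
    rw [Fin.sum_univ_castSucc, Finset.sum_range]
    simp [b]
  rw [hrange, ← hsum]
  refine (Set.encard_iUnion_le_of_fintype _).trans ?_
  rw [Nat.cast_sum]
  exact Finset.sum_le_sum fun i _ => hb i

/-- Make the state `d` absorbing. -/
noncomputable def absorb (A : CDFA α m) (d : Fin m) : CDFA α m where
  step q a := if q = d then d else A.step q a
  start := A.start
  accept := A.accept

/-- Making a dead state absorbing does not change the language. -/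
theorem lang_absorb {A : CDFA α m} {d : Fin m} (hdead : ∀ w, A.evalFrom d w ∉ A.accept) :
    (A.absorb d).lang = A.lang := by
  have habs : ∀ w, (A.absorb d).evalFrom d w = d := fun w => by
    induction w with
    | nil => rfl
    | cons a w ih => rw [evalFrom, show (A.absorb d).step d a = d from if_pos rfl, ih]
  have key : ∀ (w : List α) q,
      (A.absorb d).evalFrom q w ∈ A.accept ↔ A.evalFrom q w ∈ A.accept := by
    intro w
    induction w with
    | nil => intro q; rfl
    | cons a w ih =>
      intro q
      by_cases hq : q = d
      · subst hq
        rw [habs]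
        exact iff_of_false (hdead []) (hdead _)
      · rw [evalFrom, show (A.absorb d).step q a = A.step q a from if_neg hq, ih]
        rfl
  ext w
  exact key w A.start

end CDFA

/-- Corrected state upper bound for the concatenation of two finite
languages given by complete DFAs `A` (with `m` states, initial state `0`, dead state
`m−1`, transitions between non-dead states increasing) and `B` (with `n` states). -/
theorem concat_csc_upper {α : Type} [Fintype α] {m n : ℕ} (hm : 2 ≤ m) (hn : 2 ≤ n)
    (A : CDFA α m) (B : CDFA α n)
    (hfA : Set.Finite {w : List α | w ∈ A.lang}) (hfB : Set.Finite {w : List α | w ∈ B.lang})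
    (hstart : (A.start : ℕ) = 0)
    (hdead₁ : (⟨m - 1, by omega⟩ : Fin m) ∉ A.accept)
    (hdead₂ : ∀ w : List α, A.evalFrom ⟨m - 1, by omega⟩ w ∉ A.accept)
    (hord : ∀ (q : Fin m) (a : α), (q : ℕ) ≠ m - 1 → ((A.step q a : Fin m) : ℕ) ≠ m - 1 →
      q < A.step q a) :
    ∃ N : ℕ,
      N ≤ (∑ i ∈ Finset.range (m - 1),
              min ((Fintype.card α) ^ i)
                (∑ j ∈ Finset.range (A.fBelow i + 1), (n - 2).choose j))
          + ∑ j ∈ Finset.range (A.accept.card + 1), (n - 2).choose j ∧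
      ∃ C : CDFA α N, C.lang = A.lang * B.lang := by
  suffices h : (Set.range (A.lang * B.lang).leftQuotient).encard ≤
      (((∑ i ∈ Finset.range (m - 1), min (Fintype.card α ^ i)
        (∑ j ∈ Finset.range (A.fBelow i + 1), (n - 2).choose j)) +
          ∑ j ∈ Finset.range (A.accept.card + 1), (n - 2).choose j : ℕ) : ℕ∞) from
    CDFA.exists_lang_eq_of_encard_leftQuotient_le h
  by_cases htriv : IsEmpty α ∨ ¬ ∃ w, w ∈ B.lang
  · have hconst : (Set.range (A.lang * B.lang).leftQuotient).Subsingleton := by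
      rintro _ ⟨u, rfl⟩ _ ⟨v, rfl⟩
      rcases htriv with hα | hB
      · rw [Subsingleton.elim u v]
      · ext w
        simp only [Language.mem_leftQuotient, Language.mem_mul]
        exact iff_of_false (fun ⟨_, _, y, hy, _⟩ => hB ⟨y, hy⟩)
          fun ⟨_, _, y, hy, _⟩ => hB ⟨y, hy⟩
    refine (Set.encard_le_one_iff_subsingleton.mpr hconst).trans ?_
    rw [Finset.sum_range_succ' _ A.accept.card, Nat.choose_zero_right]
    exact_mod_cast (Nat.le_add_left _ _).trans (Nat.le_add_left _ _)
  · rw [not_or, not_isEmpty_iff, not_not] at htriv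
    obtain ⟨hα, hB⟩ := htriv
    obtain ⟨m, rfl⟩ : ∃ k, m = k + 1 := ⟨m - 1, by omega⟩
    have hlast : (⟨m + 1 - 1, by omega⟩ : Fin (m + 1)) = Fin.last m := rfl
    rw [hlast] at hdead₁ hdead₂
    rw [← CDFA.lang_absorb hdead₂]
    refine CDFA.encard_range_leftQuotient_mul_le (A := A.absorb (Fin.last m))
      (fun _ => if_pos rfl) hdead₁ (fun q a hq hqa => ?_)
      (CDFA.card_usefulNoninitial_le hfB hB)
    have hstep : (A.absorb (Fin.last m)).step q a = A.step q a := if_neg hq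
    rw [hstep] at hqa ⊢
    exact hord q a (fun h => hq (Fin.ext h)) fun h => hqa (Fin.ext h)
end
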